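/- Let n ≥ 5, a ≥ 0 and p = (n+4+2a)/(n-4). If u is a smooth solution of Δ²u = |x|^a |u|^{p-1} u on ℝ^n that is stable outside some compact set of ℝ^n, then u has finite energy: ∫_{ℝ^n} (Δu)² dx = ∫_{ℝ^n} |x|^a |u|^{p+1} dx < +∞. -/

import Mathlib

open MeasureTheory Metric Set Filter
open scoped RealInnerProductSpace Topology

noncomputable section

/-- The Laplacian of `u : ℝⁿ → ℝ` at `x`, as the sum of the pure second
partial derivatives in the coordinate directions. -/
def lap (n : ℕ) (u : EuclideanSpace ℝ (Fin n) → ℝ) (x : EuclideanSpace ℝ (Fin n)) : ℝ :=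
  ∑ i : Fin n, iteratedFDeriv ℝ 2 u x ![EuclideanSpace.single i 1, EuclideanSpace.single i 1]

/-- `u` solves `Δ²u = |x|^a |u|^(p-1) u` pointwise on `Ω`. -/
def IsSolutionOn (n : ℕ) (a p : ℝ) (u : EuclideanSpace ℝ (Fin n) → ℝ)
    (Ω : Set (EuclideanSpace ℝ (Fin n))) : Prop :=
  ∀ x ∈ Ω, lap n (lap n u) x = ‖x‖ ^ a * |u x| ^ (p - 1) * u x

/-- `u` is a stable solution on `Ω`:
`p ∫ |x|^a |u|^(p-1) ψ² ≤ ∫ (Δψ)²` for every test function `ψ ∈ C_c^∞(Ω)`. -/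
def StableOn (n : ℕ) (a p : ℝ) (u : EuclideanSpace ℝ (Fin n) → ℝ)
    (Ω : Set (EuclideanSpace ℝ (Fin n))) : Prop :=
  ∀ ψ : EuclideanSpace ℝ (Fin n) → ℝ, ContDiff ℝ (⊤ : ℕ∞) ψ → HasCompactSupport ψ →
    tsupport ψ ⊆ Ω →
    p * ∫ x, ‖x‖ ^ a * |u x| ^ (p - 1) * ψ x ^ 2 ≤ ∫ x, lap n ψ x ^ 2

/-- Surface integral of `f` over the sphere `∂B_r(x)`, with respect to the
`(n-1)`-dimensional Hausdorff measure. -/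
def sphInt (n : ℕ) (x : EuclideanSpace ℝ (Fin n)) (r : ℝ)
    (f : EuclideanSpace ℝ (Fin n) → ℝ) : ℝ :=
  ∫ y in sphere x r, f y ∂(Measure.hausdorffMeasure ((n : ℝ) - 1))

/-- Radial derivative of `u` at `y`, relative to the center `x`. -/
def radDeriv (n : ℕ) (x : EuclideanSpace ℝ (Fin n))
    (u : EuclideanSpace ℝ (Fin n) → ℝ) (y : EuclideanSpace ℝ (Fin n)) : ℝ :=
  ⟪gradient u y, ‖y - x‖⁻¹ • (y - x)⟫

/-- `ℓ₁ = (β+2)(n-4-β) + β(n-2-β)` with `β = (4+a)/(p-1)`. -/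
def ell1 (n : ℕ) (a p : ℝ) : ℝ :=
  let β : ℝ := (4 + a) / (p - 1)
  (β + 2) * ((n : ℝ) - 4 - β) + β * ((n : ℝ) - 2 - β)

/-- `ℓ₂ = β(β+2)(n-4-β)(n-2-β)` with `β = (4+a)/(p-1)`. -/
def ell2 (n : ℕ) (a p : ℝ) : ℝ :=
  let β : ℝ := (4 + a) / (p - 1)
  β * (β + 2) * ((n : ℝ) - 4 - β) * ((n : ℝ) - 2 - β)

/-- The constant `c(n,p,a) = 2(ρ - γ - 1)`, `ρ = n-1-2β`, `γ = β(β-n+2)`. -/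
def cConst (n : ℕ) (a p : ℝ) : ℝ :=
  let β : ℝ := (4 + a) / (p - 1)
  2 * (((n : ℝ) - 1 - 2 * β) - β * (β - (n : ℝ) + 2) - 1)

/-- The rescaled energy `E(r; x, u)` from the monotonicity formula. -/
def energyE (n : ℕ) (a p : ℝ) (u : EuclideanSpace ℝ (Fin n) → ℝ)
    (x : EuclideanSpace ℝ (Fin n)) (r : ℝ) : ℝ :=
  let β : ℝ := (4 + a) / (p - 1)
  r ^ (2 * β + 4 - (n : ℝ)) *
      (∫ y in ball x r,
        (1 / 2) * lap n u y ^ 2 - (1 / (p + 1)) * ‖y‖ ^ a * |u y| ^ (p + 1))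
    + β / 2 * ((n : ℝ) - 2 - β) *
        deriv (fun ρ : ℝ => ρ ^ (2 * β + 1 - (n : ℝ)) * sphInt n x ρ fun y => u y ^ 2) r
    + β / 2 * ((n : ℝ) - 2 - β) *
        deriv (fun ρ : ℝ => ρ ^ (2 * β + 2 - (n : ℝ)) * sphInt n x ρ fun y => u y ^ 2) r
    + r ^ 3 / 2 *
        deriv (fun ρ : ℝ => ρ ^ (2 * β + 1 - (n : ℝ)) *
          sphInt n x ρ fun y => (β * ρ⁻¹ * u y + radDeriv n x u y) ^ 2) r
    + 1 / 2 *
        deriv (fun ρ : ℝ => ρ ^ (2 * β + 4 - (n : ℝ)) *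
          sphInt n x ρ fun y => ‖gradient u y‖ ^ 2 - radDeriv n x u y ^ 2) r
    + 1 / 2 * r ^ (2 * β + 3 - (n : ℝ)) *
        (sphInt n x r fun y => ‖gradient u y‖ ^ 2 - radDeriv n x u y ^ 2)

end

section PartialDerivatives

variable {n : ℕ} {f g h : EuclideanSpace ℝ (Fin n) → ℝ}

/-- The partial derivative of `f` in the `i`-th coordinate direction. -/
noncomputable def pd (i : Fin n) (f : EuclideanSpace ℝ (Fin n) → ℝ) :
    EuclideanSpace ℝ (Fin n) → ℝ :=
  fun x => fderiv ℝ f x (EuclideanSpace.single i 1)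

/-- The carré du champ `∇f · ∇g`. -/
noncomputable def gradDot (f g : EuclideanSpace ℝ (Fin n) → ℝ) : EuclideanSpace ℝ (Fin n) → ℝ :=
  fun x => ∑ i, pd i f x * pd i g x

theorem ContDiff.pd (hf : ContDiff ℝ (⊤ : ℕ∞) f) (i : Fin n) : ContDiff ℝ (⊤ : ℕ∞) (pd i f) :=
  (hf.fderiv_right (m := (⊤ : ℕ∞)) (by simp)).clm_apply contDiff_const

theorem ContDiff.differentiable_of_top (hf : ContDiff ℝ (⊤ : ℕ∞) f) : Differentiable ℝ f :=
  hf.differentiable (by simp)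

theorem ContDiff.gradDot (hf : ContDiff ℝ (⊤ : ℕ∞) f) (hg : ContDiff ℝ (⊤ : ℕ∞) g) :
    ContDiff ℝ (⊤ : ℕ∞) (gradDot f g) :=
  ContDiff.sum fun i _ => (hf.pd i).mul (hg.pd i)

theorem lap_eq_sum_pd (hf : ContDiff ℝ (⊤ : ℕ∞) f) (x : EuclideanSpace ℝ (Fin n)) :
    lap n f x = ∑ i, pd i (pd i f) x := by
  unfold lap
  refine Finset.sum_congr rfl fun i _ => ?_
  rw [iteratedFDeriv_two_apply]
  have hd : DifferentiableAt ℝ (fderiv ℝ f) x :=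
    ((hf.fderiv_right (m := (⊤ : ℕ∞)) (by simp)).differentiable (by simp)) x
  unfold pd
  rw [fderiv_clm_apply hd (by fun_prop)]
  simp

theorem ContDiff.lap (hf : ContDiff ℝ (⊤ : ℕ∞) f) : ContDiff ℝ (⊤ : ℕ∞) (lap n f) := by
  rw [show _root_.lap n f = fun x => ∑ i, _root_.pd i (_root_.pd i f) x from
    funext (lap_eq_sum_pd hf)]
  exact ContDiff.sum fun i _ => (hf.pd i).pd i

theorem pd_add (hf : ContDiff ℝ (⊤ : ℕ∞) f) (hg : ContDiff ℝ (⊤ : ℕ∞) g) (i : Fin n)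
    (x : EuclideanSpace ℝ (Fin n)) : pd i (fun y => f y + g y) x = pd i f x + pd i g x := by
  unfold pd
  rw [fderiv_fun_add (hf.differentiable_of_top x) (hg.differentiable_of_top x)]
  simp

theorem pd_mul (hf : ContDiff ℝ (⊤ : ℕ∞) f) (hg : ContDiff ℝ (⊤ : ℕ∞) g) (i : Fin n)
    (x : EuclideanSpace ℝ (Fin n)) :
    pd i (fun y => f y * g y) x = f x * pd i g x + pd i f x * g x := by
  unfold pd
  rw [fderiv_fun_mul (hf.differentiable_of_top x) (hg.differentiable_of_top x)]
  simp [mul_comm]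

theorem pd_congr {x : EuclideanSpace ℝ (Fin n)} (h : f =ᶠ[𝓝 x] g) (i : Fin n) :
    pd i f =ᶠ[𝓝 x] pd i g :=
  h.fderiv.fun_comp fun T : EuclideanSpace ℝ (Fin n) →L[ℝ] ℝ => T (EuclideanSpace.single i 1)

theorem pd_comp_smul (hf : ContDiff ℝ (⊤ : ℕ∞) f) (c : ℝ) (i : Fin n) :
    pd i (fun x => f (c • x)) = fun x => c * pd i f (c • x) := by
  funext x
  have := ((hf.differentiable_of_top (c • x)).hasFDerivAt.comp x
    ((hasFDerivAt_id x).const_smul c)).fderiv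
  unfold pd
  change fderiv ℝ (f ∘ HSMul.hSMul c) x _ = _
  rw [this]
  simp

theorem pd_const (c : ℝ) (i : Fin n) : pd i (fun _ => c) = fun _ => 0 := by
  funext x
  simp [pd]

theorem gradDot_congr {f' g' : EuclideanSpace ℝ (Fin n) → ℝ} {x : EuclideanSpace ℝ (Fin n)}
    (hf : f =ᶠ[𝓝 x] f') (hg : g =ᶠ[𝓝 x] g') : gradDot f g =ᶠ[𝓝 x] gradDot f' g' := by
  have hf' : ∀ᶠ y in 𝓝 x, ∀ i, pd i f y = pd i f' y := eventually_all.2 fun i => pd_congr hf i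
  have hg' : ∀ᶠ y in 𝓝 x, ∀ i, pd i g y = pd i g' y := eventually_all.2 fun i => pd_congr hg i
  filter_upwards [hf', hg'] with y h1 h2
  simp [gradDot, h1, h2]

theorem lap_congr {x : EuclideanSpace ℝ (Fin n)} (h : f =ᶠ[𝓝 x] g) : lap n f x = lap n g x := by
  unfold lap
  rw [(Filter.EventuallyEq.iteratedFDeriv ℝ h 2).eq_of_nhds]

theorem gradDot_comp_smul (hf : ContDiff ℝ (⊤ : ℕ∞) f) (c : ℝ) :
    gradDot (fun x => f (c • x)) (fun x => f (c • x)) = fun x => c ^ 2 * gradDot f f (c • x) := by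
  funext x
  simp only [gradDot, pd_comp_smul hf, Finset.mul_sum]
  exact Finset.sum_congr rfl fun i _ => by ring

theorem contDiff_comp_smul (hf : ContDiff ℝ (⊤ : ℕ∞) f) (c : ℝ) :
    ContDiff ℝ (⊤ : ℕ∞) fun x => f (c • x) :=
  hf.comp (contDiff_const_smul c)

theorem lap_const_mul (hf : ContDiff ℝ (⊤ : ℕ∞) f) (c : ℝ) (x : EuclideanSpace ℝ (Fin n)) :
    lap n (fun y => c * f y) x = c * lap n f x := by
  rw [lap_eq_sum_pd (contDiff_const.mul hf), lap_eq_sum_pd hf, Finset.mul_sum]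
  refine Finset.sum_congr rfl fun i _ => ?_
  have h1 : pd i (fun y => c * f y) = fun y => c * pd i f y := by
    funext y; rw [pd_mul contDiff_const hf, pd_const]; simp
  rw [h1, pd_mul contDiff_const (hf.pd i), pd_const]; simp

theorem lap_comp_smul (hf : ContDiff ℝ (⊤ : ℕ∞) f) (c : ℝ) (x : EuclideanSpace ℝ (Fin n)) :
    lap n (fun x => f (c • x)) x = c ^ 2 * lap n f (c • x) := by
  rw [lap_eq_sum_pd (contDiff_comp_smul hf c), lap_eq_sum_pd hf, Finset.mul_sum]
  refine Finset.sum_congr rfl fun i _ => ?_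
  rw [pd_comp_smul hf, pd_mul contDiff_const (contDiff_comp_smul (hf.pd i) c), pd_const,
    pd_comp_smul (hf.pd i)]
  ring

theorem lap_mul (hf : ContDiff ℝ (⊤ : ℕ∞) f) (hg : ContDiff ℝ (⊤ : ℕ∞) g)
    (x : EuclideanSpace ℝ (Fin n)) :
    lap n (fun y => f y * g y) x = f x * lap n g x + 2 * gradDot f g x + g x * lap n f x := by
  rw [lap_eq_sum_pd (hf.mul hg), lap_eq_sum_pd hf, lap_eq_sum_pd hg]
  simp only [gradDot, Finset.mul_sum, ← Finset.sum_add_distrib]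
  refine Finset.sum_congr rfl fun i _ => ?_
  rw [show pd i (fun y => f y * g y) = fun y => f y * pd i g y + pd i f y * g y from
      funext (pd_mul hf hg i), pd_add (hf.mul (hg.pd i)) ((hf.pd i).mul hg),
    pd_mul hf (hg.pd i), pd_mul (hf.pd i) hg]
  ring

theorem gradDot_mul_right (hg : ContDiff ℝ (⊤ : ℕ∞) g) (hh : ContDiff ℝ (⊤ : ℕ∞) h)
    (x : EuclideanSpace ℝ (Fin n)) :
    gradDot f (fun y => g y * h y) x = g x * gradDot f h x + h x * gradDot f g x := by
  simp only [gradDot, Finset.mul_sum, ← Finset.sum_add_distrib]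
  refine Finset.sum_congr rfl fun i _ => ?_
  rw [pd_mul hg hh]
  ring

theorem gradDot_sq_le (x : EuclideanSpace ℝ (Fin n)) :
    gradDot f g x ^ 2 ≤ gradDot f f x * gradDot g g x := by
  simpa only [gradDot, sq] using
    Finset.sum_mul_sq_le_sq_mul_sq Finset.univ (fun i => pd i f x) fun i => pd i g x

theorem HasCompactSupport.pd (hf : HasCompactSupport f) (i : Fin n) :
    HasCompactSupport (pd i f) :=
  hf.fderiv_apply (𝕜 := ℝ) _

theorem HasCompactSupport.gradDot (hf : HasCompactSupport f) :
    HasCompactSupport (gradDot f g) := by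
  refine hf.mono' fun x hx => ?_
  by_contra hx'
  have h0 : f =ᶠ[𝓝 x] fun _ => 0 := notMem_tsupport_iff_eventuallyEq.1 hx'
  apply hx
  simp [_root_.gradDot, fun i => (pd_congr h0 i).eq_of_nhds, pd_const]

theorem integral_mul_pd (hf : ContDiff ℝ (⊤ : ℕ∞) f) (hg : ContDiff ℝ (⊤ : ℕ∞) g)
    (hc : HasCompactSupport g) (i : Fin n) :
    ∫ x, f x * pd i g x = -∫ x, pd i f x * g x := by
  refine integral_mul_fderiv_eq_neg_fderiv_mul_of_integrable ?_ ?_ ?_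
    (fun x _ => hf.differentiable_of_top x) fun x _ => hg.differentiable_of_top x
  · exact ((hf.pd i).continuous.mul hg.continuous).integrable_of_hasCompactSupport hc.mul_left
  · exact (hf.continuous.mul (hg.pd i).continuous).integrable_of_hasCompactSupport
      (hc.pd i).mul_left
  · exact (hf.continuous.mul hg.continuous).integrable_of_hasCompactSupport hc.mul_left

theorem integral_mul_lap (hf : ContDiff ℝ (⊤ : ℕ∞) f) (hg : ContDiff ℝ (⊤ : ℕ∞) g)
    (hc : HasCompactSupport g) :
    ∫ x, f x * lap n g x = ∫ x, lap n f x * g x := by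
  simp only [lap_eq_sum_pd hf, lap_eq_sum_pd hg, Finset.mul_sum, Finset.sum_mul]
  rw [integral_finsetSum, integral_finsetSum]
  · refine Finset.sum_congr rfl fun i _ => ?_
    rw [integral_mul_pd hf (hg.pd i) (hc.pd i), integral_mul_pd (hf.pd i) hg hc, neg_neg]
  · exact fun i _ => (((hf.pd i).pd i).continuous.mul hg.continuous).integrable_of_hasCompactSupport
      hc.mul_left
  · exact fun i _ => (hf.continuous.mul ((hg.pd i).pd i).continuous).integrable_of_hasCompactSupport
      ((hc.pd i).pd i).mul_left

end PartialDerivatives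

section Cutoff

variable {n : ℕ} {χ κ f g η : EuclideanSpace ℝ (Fin n) → ℝ} {k l : ℕ}

/-- `f` is a smooth multiple of `χ ^ k`. -/
def IsSmoothMulPow (χ : EuclideanSpace ℝ (Fin n) → ℝ) (k : ℕ) (f : EuclideanSpace ℝ (Fin n) → ℝ) :
    Prop :=
  ∃ g : EuclideanSpace ℝ (Fin n) → ℝ, ContDiff ℝ (⊤ : ℕ∞) g ∧ f = fun x => χ x ^ k * g x

theorem IsSmoothMulPow.mul (hf : IsSmoothMulPow χ k f) (hg : IsSmoothMulPow χ l g) :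
    IsSmoothMulPow χ (k + l) fun x => f x * g x := by
  obtain ⟨f', hf', rfl⟩ := hf
  obtain ⟨g', hg', rfl⟩ := hg
  exact ⟨fun x => f' x * g' x, hf'.mul hg', by funext x; ring⟩

theorem IsSmoothMulPow.sum {ι : Type*} {s : Finset ι} {F : ι → EuclideanSpace ℝ (Fin n) → ℝ}
    (h : ∀ i, IsSmoothMulPow χ k (F i)) : IsSmoothMulPow χ k fun x => ∑ i ∈ s, F i x := by
  choose G hG hF using h
  refine ⟨fun x => ∑ i ∈ s, G i x, ContDiff.sum fun i _ => hG i, ?_⟩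
  funext x
  simp [hF, Finset.mul_sum]

theorem IsSmoothMulPow.contDiff (hχ : ContDiff ℝ (⊤ : ℕ∞) χ) (hf : IsSmoothMulPow χ k f) :
    ContDiff ℝ (⊤ : ℕ∞) f := by
  obtain ⟨g, hg, rfl⟩ := hf
  exact (hχ.pow k).mul hg

theorem IsSmoothMulPow.pd (hχ : ContDiff ℝ (⊤ : ℕ∞) χ) (hf : IsSmoothMulPow χ (k + 1) f)
    (i : Fin n) : IsSmoothMulPow χ k (pd i f) := by
  obtain ⟨g, hg, rfl⟩ := hf
  have hpow : ∀ x, _root_.pd i (fun y => χ y ^ (k + 1)) x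
      = (k + 1 : ℝ) * χ x ^ k * _root_.pd i χ x := by
    intro x
    unfold _root_.pd
    rw [fderiv_fun_pow _ (hχ.differentiable_of_top x)]
    simp
  refine ⟨fun x => χ x * _root_.pd i g x + (k + 1 : ℝ) * _root_.pd i χ x * g x,
    (hχ.mul (hg.pd i)).add ((contDiff_const.mul (hχ.pd i)).mul hg), ?_⟩
  funext x
  rw [pd_mul (hχ.pow (k + 1)) hg, hpow]
  ring

theorem IsSmoothMulPow.gradDot (hχ : ContDiff ℝ (⊤ : ℕ∞) χ) (hf : IsSmoothMulPow χ (k + 1) f)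
    (hg : IsSmoothMulPow χ (l + 1) g) : IsSmoothMulPow χ (k + l) (gradDot f g) :=
  IsSmoothMulPow.sum fun i => (hf.pd hχ i).mul (hg.pd hχ i)

theorem IsSmoothMulPow.lap (hχ : ContDiff ℝ (⊤ : ℕ∞) χ) (hf : IsSmoothMulPow χ (k + 2) f) :
    IsSmoothMulPow χ k (lap n f) := by
  rw [funext (lap_eq_sum_pd (hf.contDiff hχ))]
  exact IsSmoothMulPow.sum fun i => (hf.pd hχ i).pd hχ i

theorem IsSmoothMulPow.exists_bound (hc : HasCompactSupport χ) (h0 : ∀ x, 0 ≤ χ x) (hk : k ≠ 0)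
    (hf : IsSmoothMulPow χ k f) : ∃ C, 0 ≤ C ∧ ∀ x, |f x| ≤ C * χ x ^ k := by
  obtain ⟨g, hg, rfl⟩ := hf
  obtain ⟨C, hC⟩ := hc.isCompact.exists_bound_of_continuousOn hg.continuous.continuousOn
  refine ⟨max C 0, le_max_right _ _, fun x => ?_⟩
  rw [abs_mul, abs_of_nonneg (pow_nonneg (h0 x) k), mul_comm]
  by_cases hx : x ∈ tsupport χ
  · exact mul_le_mul_of_nonneg_right ((hC x hx).trans (le_max_left _ _)) (pow_nonneg (h0 x) k)
  · simp [image_eq_zero_of_notMem_tsupport hx, hk]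

/-- A cut-off at scale `R`: outside `closedBall 0 ρ` it equals `1` up to radius `R` and then
decays to `0` before radius `2 R`, with derivatives controlled by the scale and by a power of the
cut-off itself. -/
structure IsCutoff (k : ℕ) (ρ C R : ℝ) (η : EuclideanSpace ℝ (Fin n) → ℝ) : Prop where
  contDiff : ContDiff ℝ (⊤ : ℕ∞) η
  hasCompactSupport : HasCompactSupport η
  mem_Icc : ∀ x, η x ∈ Icc (0 : ℝ) 1
  eq_one : ∀ x, ρ < ‖x‖ → ‖x‖ < R → η x = 1
  inner : ∀ x, ‖x‖ ≤ ρ →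
    |gradDot η η x| ≤ C ∧ |lap n η x| ≤ C ∧ |lap n (gradDot η η) x| ≤ C
  middle : ∀ x, ρ < ‖x‖ → ‖x‖ < R →
    gradDot η η x = 0 ∧ lap n η x = 0 ∧ lap n (gradDot η η) x = 0
  outer : ∀ x, R ≤ ‖x‖ → ∃ c ∈ Icc (0 : ℝ) 1, η x = c ^ (k + 2) ∧ (2 * R ≤ ‖x‖ → c = 0) ∧
    |gradDot η η x| ≤ C * R⁻¹ ^ 2 * (c ^ (k + 2) * c ^ k) ∧
    |lap n η x| ≤ C * R⁻¹ ^ 2 * c ^ k ∧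
    |lap n (gradDot η η) x| ≤ C * R⁻¹ ^ 4 * (c ^ k) ^ 2

theorem exists_standard_cutoff (n : ℕ) : ∃ χ : EuclideanSpace ℝ (Fin n) → ℝ,
    ContDiff ℝ (⊤ : ℕ∞) χ ∧ HasCompactSupport χ ∧ (∀ x, χ x ∈ Icc (0 : ℝ) 1) ∧
    (∀ x, ‖x‖ ≤ 1 → χ x = 1) ∧ ∀ x, 2 ≤ ‖x‖ → χ x = 0 := by
  let b : ContDiffBump (0 : EuclideanSpace ℝ (Fin n)) := ⟨1, 2, one_pos, one_lt_two⟩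
  exact ⟨b, b.contDiff, b.hasCompactSupport, fun x => ⟨b.nonneg, b.le_one⟩,
    fun x hx => b.one_of_mem_closedBall (by simpa using hx),
    fun x hx => b.zero_of_le_dist (by simpa using hx)⟩

theorem exists_isCutoff (hκ : ContDiff ℝ (⊤ : ℕ∞) κ) (hκ01 : ∀ x, κ x ∈ Icc (0 : ℝ) 1) {ρ : ℝ}
    (hκ1 : ∀ x, ρ < ‖x‖ → κ x = 1) (hk : k ≠ 0) :
    ∃ C, 0 ≤ C ∧ ∀ R, 0 < R → ρ < R → ∃ η : EuclideanSpace ℝ (Fin n) → ℝ,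
      IsCutoff k ρ C R η ∧ tsupport η ⊆ tsupport κ := by
  obtain ⟨χ, hχ, hχc, hχ01, hχ1, hχ2⟩ := exists_standard_cutoff n
  have hχ0 : ∀ x, 0 ≤ χ x := fun x => (hχ01 x).1
  have hP : IsSmoothMulPow χ (k + 2) fun x => χ x ^ (k + 2) :=
    ⟨fun _ => 1, contDiff_const, by simp⟩
  have hPN := IsSmoothMulPow.gradDot (k := k + 1) (l := k + 1) hχ hP hP
  have hPD : IsSmoothMulPow χ (k + k) (lap n _) :=
    IsSmoothMulPow.lap hχ (by convert hPN using 1; ring)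
  obtain ⟨C₁, hC₁, hN⟩ := hPN.exists_bound hχc hχ0 (by omega)
  obtain ⟨C₂, hC₂, hq⟩ := (hP.lap hχ).exists_bound hχc hχ0 hk
  obtain ⟨C₃, hC₃, hD⟩ := hPD.exists_bound hχc hχ0 (by omega)
  have hχm := hP.contDiff hχ
  have hκm : ContDiff ℝ (⊤ : ℕ∞) fun x => κ x ^ (k + 2) := hκ.pow _
  have hcpt := isCompact_closedBall (0 : EuclideanSpace ℝ (Fin n)) ρ
  obtain ⟨C₄, hN'⟩ := hcpt.exists_bound_of_continuousOn
    (hκm.gradDot hκm).continuous.continuousOn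
  obtain ⟨C₅, hq'⟩ := hcpt.exists_bound_of_continuousOn hκm.lap.continuous.continuousOn
  obtain ⟨C₆, hD'⟩ := hcpt.exists_bound_of_continuousOn
    (hκm.gradDot hκm).lap.continuous.continuousOn
  set C := max C₁ (max C₂ (max C₃ (max C₄ (max C₅ C₆)))) with hC
  have h1 : C₁ ≤ C := by simp [hC]
  have h2 : C₂ ≤ C := by simp [hC]
  have h3 : C₃ ≤ C := by simp [hC]
  have h4 : C₄ ≤ C := by simp [hC]
  have h5 : C₅ ≤ C := by simp [hC]
  have h6 : C₆ ≤ C := by simp [hC]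
  refine ⟨C, hC₁.trans h1, fun R hR hρR => ?_⟩
  have hnorm : ∀ x : EuclideanSpace ℝ (Fin n), ‖R⁻¹ • x‖ = R⁻¹ * ‖x‖ := fun x => by
    rw [norm_smul, Real.norm_of_nonneg (inv_nonneg.2 hR.le)]
  have hin : ∀ x : EuclideanSpace ℝ (Fin n), ‖x‖ ≤ R → χ (R⁻¹ • x) = 1 := fun x hx =>
    hχ1 _ (by rw [hnorm, inv_mul_le_iff₀ hR]; simpa using hx)
  have hout : ∀ x : EuclideanSpace ℝ (Fin n), 2 * R ≤ ‖x‖ → χ (R⁻¹ • x) = 0 := fun x hx =>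
    hχ2 _ (by rw [hnorm, le_inv_mul_iff₀ hR]; linarith)
  set η : EuclideanSpace ℝ (Fin n) → ℝ := fun x => (κ x * χ (R⁻¹ • x)) ^ (k + 2) with hη
  have hlt : ∀ x : EuclideanSpace ℝ (Fin n), ‖x‖ < R → η =ᶠ[𝓝 x] fun y => κ y ^ (k + 2) := by
    intro x hx
    filter_upwards [(isOpen_lt continuous_norm continuous_const).mem_nhds hx] with y hy
    simp [hη, hin y (le_of_lt hy)]
  have hgt : ∀ x : EuclideanSpace ℝ (Fin n), ρ < ‖x‖ →
      η =ᶠ[𝓝 x] fun y => χ (R⁻¹ • y) ^ (k + 2) := by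
    intro x hx
    filter_upwards [(isOpen_lt continuous_const continuous_norm).mem_nhds hx] with y hy
    simp [hη, hκ1 y hy]
  have hsupp : HasCompactSupport η := by
    refine HasCompactSupport.intro (isCompact_closedBall 0 (2 * R)) fun x hx => ?_
    simp [hη, hout x (by simpa using (not_le.1 (by simpa using hx)).le)]
  refine ⟨η, ⟨(hκ.mul (contDiff_comp_smul hχ _)).pow _, hsupp, fun x => ?_, fun x hx hx' => ?_,
    fun x hx => ?_, fun x hx hx' => ?_, fun x hx => ?_⟩, ?_⟩
  · have h01 := mul_nonneg (hκ01 x).1 (hχ01 (R⁻¹ • x)).1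
    exact ⟨pow_nonneg h01 _,
      pow_le_one₀ h01 (mul_le_one₀ (hκ01 x).2 (hχ01 _).1 (hχ01 _).2)⟩
  · simp [hη, hκ1 x hx, hin x hx'.le]
  · have he := hlt x (hx.trans_lt hρR)
    have hg := gradDot_congr he he
    have hx' : x ∈ closedBall (0 : EuclideanSpace ℝ (Fin n)) ρ := by simpa using hx
    rw [hg.eq_of_nhds, lap_congr he, lap_congr hg]
    exact ⟨(hN' x hx').trans h4, (hq' x hx').trans h5, (hD' x hx').trans h6⟩
  · have he : η =ᶠ[𝓝 x] fun _ => 1 := by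
      filter_upwards [(isOpen_lt continuous_const continuous_norm).mem_nhds hx,
        (isOpen_lt continuous_norm continuous_const).mem_nhds hx'] with y hy hy'
      simp [hη, hκ1 y hy, hin y (le_of_lt hy')]
    have hg := gradDot_congr he he
    have hz : gradDot (fun _ : EuclideanSpace ℝ (Fin n) => (1 : ℝ)) (fun _ => 1) = fun _ => 0 := by
      funext y; simp [gradDot, pd_const]
    rw [lap_congr hg, hg.eq_of_nhds, lap_congr he, hz, lap_eq_sum_pd contDiff_const,
      lap_eq_sum_pd contDiff_const]
    simp [pd_const]
  · have he := hgt x (hρR.trans_le hx)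
    have hg := gradDot_congr he he
    have hs := gradDot_comp_smul hχm R⁻¹
    have hc := hχ0 (R⁻¹ • x)
    refine ⟨χ (R⁻¹ • x), hχ01 _, he.eq_of_nhds, hout x, ?_, ?_, ?_⟩
    · rw [hg.eq_of_nhds, hs, abs_mul, abs_of_nonneg (sq_nonneg R⁻¹), mul_comm C, mul_assoc]
      refine mul_le_mul_of_nonneg_left ((hN _).trans ?_) (sq_nonneg _)
      rw [show χ (R⁻¹ • x) ^ (k + 1 + (k + 1)) = χ (R⁻¹ • x) ^ (k + 2) * χ (R⁻¹ • x) ^ k by ring]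
      gcongr
    · rw [lap_congr he, lap_comp_smul hχm, abs_mul, abs_of_nonneg (sq_nonneg R⁻¹), mul_comm C,
        mul_assoc]
      refine mul_le_mul_of_nonneg_left ((hq _).trans ?_) (sq_nonneg _)
      gcongr
    · rw [lap_congr hg, hs, lap_const_mul (contDiff_comp_smul (hχm.gradDot hχm) _),
        lap_comp_smul (hχm.gradDot hχm), ← mul_assoc, ← pow_add, abs_mul,
        abs_of_nonneg (by positivity), mul_comm C, mul_assoc]
      refine mul_le_mul_of_nonneg_left ((hD _).trans ?_) (by positivity)
      rw [← pow_mul, mul_two]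
      gcongr
  · refine closure_mono fun x hx hx0 => hx ?_
    simp [hη, hx0]

end Cutoff

section EnergyIdentities

variable {n : ℕ} {a p : ℝ} {u η : EuclideanSpace ℝ (Fin n) → ℝ}

/-- The lower-order terms produced by the cut-off `η` in the energy identities for `u`. -/
noncomputable def cutoffError (u η : EuclideanSpace ℝ (Fin n) → ℝ) (x : EuclideanSpace ℝ (Fin n)) :
    ℝ :=
  u x ^ 2 * |lap n (gradDot η η) x| + u x ^ 2 * lap n η x ^ 2 +
    |u x * lap n u x * gradDot η η x| + u x ^ 2 * gradDot η η x ^ 2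

/-- The factor multiplying `Δu` in `Δu Δ(u η²) - (Δu)² η²`. -/
noncomputable def crossTerm (u η : EuclideanSpace ℝ (Fin n) → ℝ) (x : EuclideanSpace ℝ (Fin n)) :
    ℝ :=
  4 * η x * gradDot u η x + 2 * u x * η x * lap n η x + 2 * u x * gradDot η η x

theorem eq_zero_of_notMem_tsupport {x : EuclideanSpace ℝ (Fin n)} (hx : x ∉ tsupport η) :
    η x = 0 ∧ gradDot u η x = 0 ∧ gradDot η η x = 0 ∧ lap n η x = 0 ∧
      lap n (gradDot η η) x = 0 := by
  have h0 : η =ᶠ[𝓝 x] fun _ => 0 := notMem_tsupport_iff_eventuallyEq.1 hx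
  have hg := gradDot_congr h0 h0
  have hz : gradDot (fun _ : EuclideanSpace ℝ (Fin n) => (0 : ℝ)) (fun _ => 0) = fun _ => 0 := by
    funext y; simp [gradDot, pd_const]
  refine ⟨h0.eq_of_nhds, ?_, ?_, ?_, ?_⟩
  · simp [gradDot, fun i => (pd_congr h0 i).eq_of_nhds, pd_const]
  · rw [hg.eq_of_nhds, hz]
  · rw [lap_congr h0, lap_eq_sum_pd contDiff_const]; simp [pd_const]
  · rw [lap_congr hg, hz, lap_eq_sum_pd contDiff_const]; simp [pd_const]

theorem integrable_of_eq_zero_off_tsupport {f : EuclideanSpace ℝ (Fin n) → ℝ}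
    (hc : HasCompactSupport η) (hf : Continuous f) (h0 : ∀ x, x ∉ tsupport η → f x = 0) :
    Integrable f :=
  hf.integrable_of_hasCompactSupport (HasCompactSupport.intro hc h0)

theorem continuous_weight (ha : 0 ≤ a) (hu : ContDiff ℝ (⊤ : ℕ∞) u) (q : ℝ) (hq : 0 ≤ q) :
    Continuous fun x => ‖x‖ ^ a * |u x| ^ q :=
  (continuous_norm.rpow_const fun _ => Or.inr ha).mul
    (hu.continuous.abs.rpow_const fun _ => Or.inr hq)

theorem integrable_weight_mul_sq (ha : 0 ≤ a) (hp : 1 < p) (hu : ContDiff ℝ (⊤ : ℕ∞) u)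
    (hη : ContDiff ℝ (⊤ : ℕ∞) η) (hc : HasCompactSupport η) :
    Integrable fun x => ‖x‖ ^ a * |u x| ^ (p + 1) * η x ^ 2 := by
  have hW := continuous_weight ha hu (p + 1) (by linarith)
  have hcη := hη.continuous
  refine integrable_of_eq_zero_off_tsupport hc (by fun_prop) fun x hx => ?_
  simp [(eq_zero_of_notMem_tsupport (u := u) hx).1]

theorem integrable_lap_sq_mul_sq (hu : ContDiff ℝ (⊤ : ℕ∞) u)
    (hη : ContDiff ℝ (⊤ : ℕ∞) η) (hc : HasCompactSupport η) :
    Integrable fun x => lap n u x ^ 2 * η x ^ 2 := by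
  have h1 := hu.lap.continuous
  have h2 := hη.continuous
  refine integrable_of_eq_zero_off_tsupport hc (by fun_prop) fun x hx => ?_
  simp [(eq_zero_of_notMem_tsupport (u := u) hx).1]

theorem integrable_cutoffError (hu : ContDiff ℝ (⊤ : ℕ∞) u) (hη : ContDiff ℝ (⊤ : ℕ∞) η)
    (hc : HasCompactSupport η) : Integrable (cutoffError u η) := by
  have h1 := hu.continuous
  have h2 := hu.lap.continuous
  have h3 := hη.lap.continuous
  have h4 := (hη.gradDot hη).continuous
  have h5 := (hη.gradDot hη).lap.continuous
  refine integrable_of_eq_zero_off_tsupport hc (by unfold cutoffError; fun_prop) fun x hx => ?_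
  obtain ⟨e1, e2, e3, e4, e5⟩ := eq_zero_of_notMem_tsupport (u := u) hx
  simp [cutoffError, e3, e4, e5]

theorem integrable_gradDot_sq (hu : ContDiff ℝ (⊤ : ℕ∞) u) (hη : ContDiff ℝ (⊤ : ℕ∞) η)
    (hc : HasCompactSupport η) : Integrable fun x => gradDot u η x ^ 2 := by
  have h1 := (hu.gradDot hη).continuous
  refine integrable_of_eq_zero_off_tsupport hc (by fun_prop) fun x hx => ?_
  simp [(eq_zero_of_notMem_tsupport (u := u) hx).2.1]

theorem continuous_crossTerm (hu : ContDiff ℝ (⊤ : ℕ∞) u) (hη : ContDiff ℝ (⊤ : ℕ∞) η) :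
    Continuous (crossTerm u η) := by
  have h1 := hu.continuous
  have h2 := hη.continuous
  have h3 := hη.lap.continuous
  have h4 := (hη.gradDot hη).continuous
  have h5 := (hu.gradDot hη).continuous
  unfold crossTerm
  fun_prop

theorem crossTerm_eq_zero {x : EuclideanSpace ℝ (Fin n)} (hx : x ∉ tsupport η) :
    crossTerm u η x = 0 := by
  obtain ⟨e1, e2, e3, e4, e5⟩ := eq_zero_of_notMem_tsupport (u := u) hx
  simp [crossTerm, e1, e3]

theorem integrable_lap_mul_crossTerm (hu : ContDiff ℝ (⊤ : ℕ∞) u) (hη : ContDiff ℝ (⊤ : ℕ∞) η)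
    (hc : HasCompactSupport η) : Integrable fun x => lap n u x * crossTerm u η x := by
  have h1 := hu.lap.continuous
  have h2 := continuous_crossTerm hu hη
  refine integrable_of_eq_zero_off_tsupport hc (by fun_prop) fun x hx => ?_
  simp [crossTerm_eq_zero hx]

theorem integral_weight_mul_sq (hp : 1 < p) (hu : ContDiff ℝ (⊤ : ℕ∞) u)
    (hη : ContDiff ℝ (⊤ : ℕ∞) η) (hc : HasCompactSupport η)
    (hsol : IsSolutionOn n a p u Set.univ) :
    ∫ x, ‖x‖ ^ a * |u x| ^ (p + 1) * η x ^ 2 =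
      (∫ x, lap n u x ^ 2 * η x ^ 2) + ∫ x, lap n u x * crossTerm u η x := by
  rw [← integral_add (integrable_lap_sq_mul_sq hu hη hc) (integrable_lap_mul_crossTerm hu hη hc)]
  have key := integral_mul_lap hu.lap (hu.mul (hη.mul hη)) (hc.mul_right.mul_left)
  calc _ = ∫ x, lap n (lap n u) x * (u x * (η x * η x)) := by
        congr 1; funext x
        rw [hsol x (mem_univ x)]
        have : |u x| ^ (p + 1) = |u x| ^ (p - 1) * (u x * u x) := by
          rw [show p + 1 = p - 1 + 2 by ring, Real.rpow_add_of_nonneg (abs_nonneg _)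
            (by linarith) (by norm_num), Real.rpow_two, sq_abs, sq]
        rw [this]; ring
    _ = _ := by
        rw [← key]
        congr 1; funext x
        rw [lap_mul hu (hη.mul hη), lap_mul hη hη, gradDot_mul_right hη hη]
        unfold crossTerm
        ring

theorem integral_gradDot_sq_le (hu : ContDiff ℝ (⊤ : ℕ∞) u) (hη : ContDiff ℝ (⊤ : ℕ∞) η)
    (hc : HasCompactSupport η) :
    ∫ x, gradDot u η x ^ 2 ≤ ∫ x, cutoffError u η x := by
  have hN := hη.gradDot hη
  have h1 := hu.continuous
  have h2 := hu.lap.continuous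
  have h3 := hN.continuous
  have h4 := hN.lap.continuous
  have key := integral_mul_lap (hu.mul hu) hN hc.gradDot
  have hi1 : Integrable fun x => u x * u x * lap n (gradDot η η) x :=
    integrable_of_eq_zero_off_tsupport hc (by fun_prop) fun x hx => by
      simp [(eq_zero_of_notMem_tsupport (u := u) hx).2.2.2.2]
  have hi2 : Integrable fun x => lap n (fun y => u y * u y) x * gradDot η η x :=
    have h5 := (hu.mul hu).lap.continuous
    integrable_of_eq_zero_off_tsupport hc (by fun_prop) fun x hx => by
      simp [(eq_zero_of_notMem_tsupport (u := u) hx).2.2.1]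
  have hi : Integrable fun x => (1 / 2) * (lap n (fun y => u y * u y) x * gradDot η η x -
      u x * u x * lap n (gradDot η η) x) := (hi2.sub hi1).const_mul _
  have hle : ∫ x, gradDot u η x ^ 2 ≤ ∫ x, (cutoffError u η x + (1 / 2) *
      (lap n (fun y => u y * u y) x * gradDot η η x - u x * u x * lap n (gradDot η η) x)) := by
    refine integral_mono (integrable_gradDot_sq hu hη hc)
      ((integrable_cutoffError hu hη hc).add hi) fun x => ?_
    refine (gradDot_sq_le x).trans ?_
    rw [lap_mul hu hu]
    unfold cutoffError
    have e1 := neg_abs_le (u x * lap n u x * gradDot η η x)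
    have e2 := mul_le_mul_of_nonneg_left (le_abs_self (lap n (gradDot η η) x)) (sq_nonneg (u x))
    have e3 := mul_nonneg (sq_nonneg (u x)) (abs_nonneg (lap n (gradDot η η) x))
    have e4 := mul_nonneg (sq_nonneg (u x)) (sq_nonneg (lap n η x))
    have e5 := mul_nonneg (sq_nonneg (u x)) (sq_nonneg (gradDot η η x))
    nlinarith
  rwa [integral_add (integrable_cutoffError hu hη hc) hi,
    integral_const_mul, integral_sub hi2 hi1, key, sub_self, mul_zero, add_zero] at hle

theorem integral_lap_sq_le (hp : 1 < p) (hu : ContDiff ℝ (⊤ : ℕ∞) u)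
    (hη : ContDiff ℝ (⊤ : ℕ∞) η) (hc : HasCompactSupport η)
    (hsol : IsSolutionOn n a p u Set.univ) :
    ∫ x, lap n u x ^ 2 * η x ^ 2 ≤
      2 * (∫ x, ‖x‖ ^ a * |u x| ^ (p + 1) * η x ^ 2) + 40 * ∫ x, cutoffError u η x := by
  have hG := integrable_gradDot_sq hu hη hc
  have hS := integrable_cutoffError hu hη hc
  have hL := integrable_lap_sq_mul_sq hu hη hc
  have hLY := integrable_lap_mul_crossTerm hu hη hc
  have hGS : Integrable fun x => 16 * gradDot u η x ^ 2 + 4 * cutoffError u η x :=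
    (hG.const_mul _).add (hS.const_mul _)
  have hle : ∫ x, -(lap n u x * crossTerm u η x) ≤ ∫ x, ((1 / 2) * (lap n u x ^ 2 * η x ^ 2) +
      (16 * gradDot u η x ^ 2 + 4 * cutoffError u η x)) := by
    refine integral_mono hLY.neg
      ((hL.const_mul _).add hGS) fun x => ?_
    dsimp only
    unfold crossTerm cutoffError
    have e1 := neg_abs_le (u x * lap n u x * gradDot η η x)
    have e2 := mul_nonneg (sq_nonneg (u x)) (abs_nonneg (lap n (gradDot η η) x))
    have e3 := mul_nonneg (sq_nonneg (u x)) (sq_nonneg (gradDot η η x))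
    have e4 := sq_nonneg (lap n u x * η x / 2 + 4 * gradDot u η x)
    have e5 := sq_nonneg (lap n u x * η x / 2 + 2 * (u x * lap n η x))
    have e6 := abs_nonneg (u x * lap n u x * gradDot η η x)
    nlinarith
  rw [integral_neg, integral_add (hL.const_mul _) hGS,
    integral_add (hG.const_mul _) (hS.const_mul _), integral_const_mul, integral_const_mul,
    integral_const_mul] at hle
  have h1 := integral_weight_mul_sq hp hu hη hc hsol
  have h2 := integral_gradDot_sq_le hu hη hc
  linarith

theorem integral_weight_le_of_stableOn (hp : 1 < p) (hu : ContDiff ℝ (⊤ : ℕ∞) u)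
    (hη : ContDiff ℝ (⊤ : ℕ∞) η) (hc : HasCompactSupport η)
    (hsol : IsSolutionOn n a p u Set.univ) {Ω : Set (EuclideanSpace ℝ (Fin n))}
    (hstab : StableOn n a p u Ω) (hηΩ : tsupport η ⊆ Ω) :
    (p - 1) * (∫ x, ‖x‖ ^ a * |u x| ^ (p + 1) * η x ^ 2) ≤ 9 * ∫ x, cutoffError u η x := by
  have hG := integrable_gradDot_sq hu hη hc
  have hS := integrable_cutoffError hu hη hc
  have hL := integrable_lap_sq_mul_sq hu hη hc
  have hLY := integrable_lap_mul_crossTerm hu hη hc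
  have hs := hstab (fun x => u x * η x) (hu.mul hη) hc.mul_left
    ((closure_mono (Function.support_mul_subset_right u η)).trans hηΩ)
  have hlhs : ∀ x : EuclideanSpace ℝ (Fin n), ‖x‖ ^ a * |u x| ^ (p - 1) * (u x * η x) ^ 2
      = ‖x‖ ^ a * |u x| ^ (p + 1) * η x ^ 2 := fun x => by
    rw [show p + 1 = p - 1 + 2 by ring, Real.rpow_add_of_nonneg (abs_nonneg _)
      (by linarith) (by norm_num), Real.rpow_two, sq_abs]
    ring
  simp only [hlhs] at hs
  have hcψ : Continuous (lap n fun x => u x * η x) := (hu.mul hη).lap.continuous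
  have hLL : Integrable fun x => lap n u x ^ 2 * η x ^ 2 + lap n u x * crossTerm u η x :=
    hL.add hLY
  have hGS : Integrable fun x => 6 * gradDot u η x ^ 2 + 3 * cutoffError u η x :=
    (hG.const_mul _).add (hS.const_mul _)
  have hle : ∫ x, lap n (fun y => u y * η y) x ^ 2 ≤ ∫ x, ((lap n u x ^ 2 * η x ^ 2 +
      lap n u x * crossTerm u η x) + (6 * gradDot u η x ^ 2 + 3 * cutoffError u η x)) := by
    refine integral_mono (integrable_of_eq_zero_off_tsupport hc (by fun_prop) fun x hx => ?_)
      (hLL.add hGS) fun x => ?_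
    · obtain ⟨e1, e2, e3, e4, e5⟩ := eq_zero_of_notMem_tsupport (u := u) hx
      rw [lap_mul hu hη, e1, e2, e4]
      ring
    dsimp only
    rw [lap_mul hu hη]
    unfold crossTerm cutoffError
    have e1 := neg_abs_le (u x * lap n u x * gradDot η η x)
    have e2 := mul_nonneg (sq_nonneg (u x)) (abs_nonneg (lap n (gradDot η η) x))
    have e3 := mul_nonneg (sq_nonneg (u x)) (sq_nonneg (gradDot η η x))
    have e4 := sq_nonneg (u x * lap n η x - gradDot u η x)
    have e6 := abs_nonneg (u x * lap n u x * gradDot η η x)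
    nlinarith
  rw [integral_add hLL hGS, integral_add hL hLY,
    integral_add (hG.const_mul _) (hS.const_mul _), integral_const_mul,
    integral_const_mul, ← integral_weight_mul_sq hp hu hη hc hsol] at hle
  have h2 := integral_gradDot_sq_le hu hη hc
  linarith

theorem integral_crossTerm_sq_le (hu : ContDiff ℝ (⊤ : ℕ∞) u) (hη : ContDiff ℝ (⊤ : ℕ∞) η)
    (hc : HasCompactSupport η) (hη01 : ∀ x, η x ∈ Icc (0 : ℝ) 1) :
    ∫ x, crossTerm u η x ^ 2 ≤ 60 * ∫ x, cutoffError u η x := by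
  have hG := integrable_gradDot_sq hu hη hc
  have hS := integrable_cutoffError hu hη hc
  have hcY := continuous_crossTerm hu hη
  have hle : ∫ x, crossTerm u η x ^ 2 ≤
      ∫ x, (48 * gradDot u η x ^ 2 + 12 * cutoffError u η x) := by
    refine integral_mono (integrable_of_eq_zero_off_tsupport hc (by fun_prop) fun x hx => ?_)
      ((hG.const_mul _).add (hS.const_mul _)) fun x => ?_
    · simp [crossTerm_eq_zero hx]
    dsimp only
    have hη2 : η x ^ 2 ≤ 1 := pow_le_one₀ (hη01 x).1 (hη01 x).2
    have f1 := mul_le_mul_of_nonneg_right hη2 (sq_nonneg (gradDot u η x))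
    have f2 := mul_le_mul_of_nonneg_right hη2 (sq_nonneg (u x * lap n η x))
    have e2 := mul_nonneg (sq_nonneg (u x)) (abs_nonneg (lap n (gradDot η η) x))
    have e6 := abs_nonneg (u x * lap n u x * gradDot η η x)
    have hsq : ∀ A B D : ℝ, (A + B + D) ^ 2 ≤ 3 * (A ^ 2 + B ^ 2 + D ^ 2) := fun A B D => by
      nlinarith [sq_nonneg (A - B), sq_nonneg (A - D), sq_nonneg (B - D)]
    unfold crossTerm cutoffError
    refine (hsq _ _ _).trans ?_
    nlinarith
  rw [integral_add (hG.const_mul _) (hS.const_mul _), integral_const_mul,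
    integral_const_mul] at hle
  have h2 := integral_gradDot_sq_le hu hη hc
  linarith

end EnergyIdentities

section UniformBounds

variable {n k : ℕ} {a p : ℝ} {u : EuclideanSpace ℝ (Fin n) → ℝ}

/-- Scale-invariant Young inequality at the critical exponent. -/
theorem sq_mul_inv_pow_le_of_critical (hp : 1 < p) (hcrit : 4 + 2 * (a + 4) / (p - 1) = n) {δ R t : ℝ}
    (hδ : 0 < δ) (hR : 0 < R) (ht : 0 ≤ t) :
    t ^ 2 * R⁻¹ ^ 4 ≤ δ * (R ^ a * t ^ (p + 1)) + δ⁻¹ ^ (2 / (p - 1)) * R⁻¹ ^ n := by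
  have hp1 : 0 < p - 1 := by linarith
  have hRi : 0 < R⁻¹ := inv_pos.2 hR
  have hδi : 0 < δ⁻¹ := inv_pos.2 hδ
  by_cases h : δ⁻¹ * R⁻¹ ^ (a + 4) ≤ t ^ (p - 1)
  · have h1 : R⁻¹ ^ 4 ≤ δ * (R ^ a * t ^ (p - 1)) := by
      calc R⁻¹ ^ 4 = δ * (R ^ a * (δ⁻¹ * R⁻¹ ^ (a + 4))) := by
            rw [Real.rpow_add hRi, Real.inv_rpow hR.le, show (4 : ℝ) = (4 : ℕ) by norm_num,
              Real.rpow_natCast]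
            field_simp
        _ ≤ _ := by gcongr
    have h2 : t ^ (p + 1) = t ^ (p - 1) * t ^ 2 := by
      rw [show p + 1 = p - 1 + 2 by ring, Real.rpow_add_of_nonneg ht (by linarith) (by norm_num),
        Real.rpow_two]
    calc t ^ 2 * R⁻¹ ^ 4 ≤ t ^ 2 * (δ * (R ^ a * t ^ (p - 1))) := by gcongr
      _ = δ * (R ^ a * t ^ (p + 1)) := by rw [h2]; ring
      _ ≤ _ := le_add_of_nonneg_right (by positivity)
  · have h1 : t ^ 2 ≤ (δ⁻¹ * R⁻¹ ^ (a + 4)) ^ (2 / (p - 1)) := by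
      calc t ^ 2 = (t ^ (p - 1)) ^ (2 / (p - 1)) := by
            rw [← Real.rpow_mul ht, mul_div_cancel₀ _ hp1.ne', Real.rpow_two]
        _ ≤ _ := Real.rpow_le_rpow (Real.rpow_nonneg ht _) (not_le.1 h).le (by positivity)
    have h2 : R⁻¹ ^ n = (R⁻¹ ^ (a + 4)) ^ (2 / (p - 1)) * R⁻¹ ^ 4 := by
      rw [← Real.rpow_mul hRi.le, ← Real.rpow_natCast, ← Real.rpow_natCast _ 4,
        ← Real.rpow_add hRi, ← hcrit]
      congr 1
      push_cast
      ring
    calc t ^ 2 * R⁻¹ ^ 4 ≤ (δ⁻¹ * R⁻¹ ^ (a + 4)) ^ (2 / (p - 1)) * R⁻¹ ^ 4 := by gcongr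
      _ = δ⁻¹ ^ (2 / (p - 1)) * R⁻¹ ^ n := by
          rw [h2, Real.mul_rpow hδi.le (by positivity)]; ring
      _ ≤ _ := le_add_of_nonneg_left (by positivity)

theorem rpow_le_sq_of_mem_Icc {c : ℝ} (hc : c ∈ Icc (0 : ℝ) 1) (hp : 1 < p)
    (hk : 4 ≤ k * (p - 1)) : (c ^ k) ^ (p + 1) ≤ (c ^ (k + 2)) ^ 2 := by
  have hk0 : k ≠ 0 := by rintro rfl; norm_num at hk
  rcases hc.1.eq_or_lt with rfl | h0
  · rw [zero_pow hk0, Real.zero_rpow (by linarith)]; simp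
  · rw [← Real.rpow_natCast c k, ← Real.rpow_mul h0.le, ← pow_mul, ← Real.rpow_natCast]
    refine Real.rpow_le_rpow_of_exponent_ge h0 hc.2 ?_
    push_cast
    linarith

theorem exists_cutoffError_le (ha : 0 ≤ a) (hp : 1 < p) (hcrit : 4 + 2 * (a + 4) / (p - 1) = n)
    (hk : 4 ≤ k * (p - 1)) (hu : ContDiff ℝ (⊤ : ℕ∞) u) {ρ C ε : ℝ} (hC : 0 ≤ C) (hε : 0 < ε) :
    ∃ M, 0 ≤ M ∧ ∀ R, 0 < R → ∀ η, IsCutoff k ρ C R η → ∀ x,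
      cutoffError u η x ≤
        ε * (lap n u x ^ 2 * η x ^ 2 + ‖x‖ ^ a * |u x| ^ (p + 1) * η x ^ 2) +
        ((closedBall 0 ρ).indicator (fun _ => M) x +
          (closedBall 0 (2 * R)).indicator (fun _ => M * R⁻¹ ^ n) x) := by
  have hcpt := isCompact_closedBall (0 : EuclideanSpace ℝ (Fin n)) ρ
  obtain ⟨A₀, hA⟩ := hcpt.exists_bound_of_continuousOn hu.continuous.continuousOn
  obtain ⟨B₀, hB⟩ := hcpt.exists_bound_of_continuousOn hu.lap.continuous.continuousOn
  set A := max A₀ 0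
  set B := max B₀ 0
  have hA0 : 0 ≤ A := le_max_right _ _
  have hB0 : 0 ≤ B := le_max_right _ _
  set T := C + 2 * C ^ 2 + C ^ 2 / (4 * ε) with hT
  have hT0 : 0 ≤ T := by positivity
  set δ := ε / (T + 1) with hδ
  have hδ0 : 0 < δ := by positivity
  have hTδ : T * δ ≤ ε := by
    rw [hδ, mul_div_assoc', div_le_iff₀ (by positivity)]; nlinarith
  set M := max (A ^ 2 * C + A ^ 2 * C ^ 2 + A * B * C + A ^ 2 * C ^ 2)
    (T * δ⁻¹ ^ (2 / (p - 1)))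
  have hM0 : 0 ≤ M := le_max_of_le_left (by positivity)
  refine ⟨M, hM0, fun R hR η hη x => ?_⟩
  have hind1 : 0 ≤ (closedBall (0 : EuclideanSpace ℝ (Fin n)) ρ).indicator (fun _ => M) x :=
    indicator_nonneg (fun _ _ => hM0) x
  have hind2 : 0 ≤ (closedBall (0 : EuclideanSpace ℝ (Fin n)) (2 * R)).indicator
      (fun _ => M * R⁻¹ ^ n) x := indicator_nonneg (fun _ _ => by positivity) x
  have hmain : 0 ≤ ε * (lap n u x ^ 2 * η x ^ 2 + ‖x‖ ^ a * |u x| ^ (p + 1) * η x ^ 2) := by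
    positivity
  unfold cutoffError
  by_cases hxρ : ‖x‖ ≤ ρ
  · have hx : x ∈ closedBall (0 : EuclideanSpace ℝ (Fin n)) ρ := by simpa using hxρ
    obtain ⟨h1, h2, h3⟩ := hη.inner x hxρ
    have hA' : |u x| ≤ A := (hA x hx).trans (le_max_left _ _)
    have hB' : |lap n u x| ≤ B := (hB x hx).trans (le_max_left _ _)
    rw [indicator_of_mem hx]
    rw [abs_mul, abs_mul, ← sq_abs (u x), ← sq_abs (lap n η x), ← sq_abs (gradDot η η x)]
    have : |u x| ^ 2 * |lap n (gradDot η η) x| + |u x| ^ 2 * |lap n η x| ^ 2 +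
        |u x| * |lap n u x| * |gradDot η η x| + |u x| ^ 2 * |gradDot η η x| ^ 2 ≤
        A ^ 2 * C + A ^ 2 * C ^ 2 + A * B * C + A ^ 2 * C ^ 2 := by gcongr
    have := this.trans (le_max_left _ (T * δ⁻¹ ^ (2 / (p - 1))))
    linarith
  rw [not_le] at hxρ
  by_cases hxR : ‖x‖ < R
  · obtain ⟨h1, h2, h3⟩ := hη.middle x hxρ hxR
    rw [h1, h2, h3]
    simp only [abs_zero, mul_zero, zero_pow two_ne_zero, add_zero]
    linarith
  rw [not_lt] at hxR
  obtain ⟨c, hc, hηc, hc0, h1, h2, h3⟩ := hη.outer x hxR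
  have hck : 0 ≤ c ^ k := pow_nonneg hc.1 k
  set t := |u x| * c ^ k with ht
  have ht0 : 0 ≤ t := by positivity
  set Λ := |lap n u x| * η x with hΛ
  have hη0 := (hη.mem_Icc x).1
  have hη1 := (hη.mem_Icc x).2
  have hstep : |u x| ^ 2 * |lap n (gradDot η η) x| + |u x| ^ 2 * |lap n η x| ^ 2 +
        |u x| * |lap n u x| * |gradDot η η x| + |u x| ^ 2 * |gradDot η η x| ^ 2 ≤
      T * (t ^ 2 * R⁻¹ ^ 4) + ε * Λ ^ 2 := by
    have hN2 : |gradDot η η x| ≤ C * R⁻¹ ^ 2 * c ^ k := h1.trans <| by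
      refine mul_le_mul_of_nonneg_left ?_ (by positivity)
      exact mul_le_of_le_one_left hck (hηc ▸ hη1)
    have hN1 : |gradDot η η x| ≤ C * R⁻¹ ^ 2 * (η x * c ^ k) := hηc ▸ h1
    calc _ ≤ |u x| ^ 2 * (C * R⁻¹ ^ 4 * (c ^ k) ^ 2) + |u x| ^ 2 * (C * R⁻¹ ^ 2 * c ^ k) ^ 2 +
        |u x| * |lap n u x| * (C * R⁻¹ ^ 2 * (η x * c ^ k)) +
        |u x| ^ 2 * (C * R⁻¹ ^ 2 * c ^ k) ^ 2 := by gcongr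
      _ = (C + 2 * C ^ 2) * (t ^ 2 * R⁻¹ ^ 4) + C * (t * R⁻¹ ^ 2) * Λ := by rw [ht, hΛ]; ring
      _ ≤ (C + 2 * C ^ 2) * (t ^ 2 * R⁻¹ ^ 4) +
          (C ^ 2 / (4 * ε) * (t ^ 2 * R⁻¹ ^ 4) + ε * Λ ^ 2) := by
        gcongr
        have hid : C ^ 2 / (4 * ε) * (t ^ 2 * R⁻¹ ^ 4) + ε * Λ ^ 2 - C * (t * R⁻¹ ^ 2) * Λ =
            (C * (t * R⁻¹ ^ 2) - 2 * ε * Λ) ^ 2 / (4 * ε) := by field_simp; ring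
        have : 0 ≤ (C * (t * R⁻¹ ^ 2) - 2 * ε * Λ) ^ 2 / (4 * ε) := by positivity
        linarith
      _ = _ := by rw [hT]; ring
  have hΛ2 : Λ ^ 2 = lap n u x ^ 2 * η x ^ 2 := by rw [hΛ, mul_pow, sq_abs]
  have hyoung : T * (t ^ 2 * R⁻¹ ^ 4) ≤ ε * (‖x‖ ^ a * |u x| ^ (p + 1) * η x ^ 2) +
      (closedBall (0 : EuclideanSpace ℝ (Fin n)) (2 * R)).indicator (fun _ => M * R⁻¹ ^ n) x := by
    by_cases hx2 : ‖x‖ ≤ 2 * R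
    · rw [indicator_of_mem (by simpa using hx2)]
      have hW : R ^ a * t ^ (p + 1) ≤ ‖x‖ ^ a * |u x| ^ (p + 1) * η x ^ 2 := by
        rw [ht, Real.mul_rpow (abs_nonneg _) hck, ← mul_assoc, hηc]
        have := rpow_le_sq_of_mem_Icc hc hp hk
        gcongr
      calc T * (t ^ 2 * R⁻¹ ^ 4)
          ≤ T * (δ * (R ^ a * t ^ (p + 1)) + δ⁻¹ ^ (2 / (p - 1)) * R⁻¹ ^ n) :=
            mul_le_mul_of_nonneg_left (sq_mul_inv_pow_le_of_critical hp hcrit hδ0 hR ht0) hT0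
        _ = T * δ * (R ^ a * t ^ (p + 1)) + T * δ⁻¹ ^ (2 / (p - 1)) * R⁻¹ ^ n := by ring
        _ ≤ _ := by
            gcongr
            exact le_max_right _ _
    · have : t = 0 := by
        rw [ht, hc0 (not_le.1 hx2).le, zero_pow, mul_zero]
        rintro rfl
        norm_num at hk
      rw [this]
      have : 0 ≤ ε * (‖x‖ ^ a * |u x| ^ (p + 1) * η x ^ 2) := by positivity
      simp only [zero_pow two_ne_zero, zero_mul, mul_zero]
      linarith
  rw [abs_mul, abs_mul, ← sq_abs (u x), ← sq_abs (lap n η x), ← sq_abs (gradDot η η x)]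
  rw [hΛ2] at hstep
  linarith

theorem exists_integral_cutoffError_le (ha : 0 ≤ a) (hp : 1 < p)
    (hcrit : 4 + 2 * (a + 4) / (p - 1) = n)
    (hk : 4 ≤ k * (p - 1)) (hu : ContDiff ℝ (⊤ : ℕ∞) u) {ρ C ε : ℝ} (hC : 0 ≤ C) (hε : 0 < ε) :
    ∃ M, ∀ R, 0 < R → ∀ η, IsCutoff k ρ C R η →
      ∫ x, cutoffError u η x ≤ ε * ((∫ x, lap n u x ^ 2 * η x ^ 2) +
        ∫ x, ‖x‖ ^ a * |u x| ^ (p + 1) * η x ^ 2) + M := by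
  obtain ⟨M, hM0, hM⟩ := exists_cutoffError_le (k := k) (ρ := ρ) ha hp hcrit hk hu hC hε
  refine ⟨volume.real (closedBall (0 : EuclideanSpace ℝ (Fin n)) ρ) * M +
    2 ^ n * volume.real (ball (0 : EuclideanSpace ℝ (Fin n)) 1) * M, fun R hR η hη => ?_⟩
  have hL := integrable_lap_sq_mul_sq hu hη.contDiff hη.hasCompactSupport
  have hW := integrable_weight_mul_sq ha hp hu hη.contDiff hη.hasCompactSupport
  have hi : ∀ r m : ℝ, Integrable
      ((closedBall (0 : EuclideanSpace ℝ (Fin n)) r).indicator fun _ => m) := fun r m =>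
    (integrable_indicator_iff measurableSet_closedBall).2
      (integrableOn_const measure_closedBall_lt_top.ne)
  have h1 : Integrable fun x => ε * (lap n u x ^ 2 * η x ^ 2 +
      ‖x‖ ^ a * |u x| ^ (p + 1) * η x ^ 2) := (hL.add hW).const_mul _
  have h2 : Integrable fun x => (closedBall (0 : EuclideanSpace ℝ (Fin n)) ρ).indicator
        (fun _ => M) x + (closedBall 0 (2 * R)).indicator (fun _ => M * R⁻¹ ^ n) x :=
    (hi _ _).add (hi _ _)
  refine (integral_mono (integrable_cutoffError hu hη.contDiff hη.hasCompactSupport)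
    (h1.add h2) (hM R hR η hη)).trans ?_
  refine le_of_eq ?_
  simp only [Pi.add_apply]
  rw [integral_add h1 h2, integral_add (hi _ _) (hi _ _), integral_const_mul, integral_add hL hW,
    integral_indicator_const _ measurableSet_closedBall,
    integral_indicator_const _ measurableSet_closedBall,
    Measure.addHaar_real_closedBall volume (0 : EuclideanSpace ℝ (Fin n))
      (by positivity : 0 ≤ 2 * R)]
  simp only [finrank_euclideanSpace, Fintype.card_fin, smul_eq_mul]
  rw [mul_pow, inv_pow]
  field_simp

end UniformBounds

section FiniteEnergy

variable {n k : ℕ} {a p : ℝ} {u : EuclideanSpace ℝ (Fin n) → ℝ}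

theorem integrable_of_forall_cutoff_le {f : EuclideanSpace ℝ (Fin n) → ℝ} (hf : Continuous f)
    (h0 : ∀ x, 0 ≤ f x) {ρ C B : ℝ}
    (h : ∀ R, 0 < R → ρ < R → ∃ η, IsCutoff k ρ C R η ∧ ∫ x, f x * η x ^ 2 ≤ B) :
    Integrable f := by
  have hcb : IntegrableOn f (closedBall 0 ρ) :=
    hf.continuousOn.integrableOn_compact (isCompact_closedBall _ _)
  refine (aecover_ball (μ := volume) (x := (0 : EuclideanSpace ℝ (Fin n)))
    (tendsto_id (α := ℝ) (x := atTop))).integrable_of_integral_bounded_of_nonneg_ae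
    ((∫ x in closedBall 0 ρ, f x) + B)
    (fun R => (hf.continuousOn.integrableOn_compact
      (isCompact_closedBall (0 : EuclideanSpace ℝ (Fin n)) R)).mono_set ball_subset_closedBall)
    (Eventually.of_forall h0) ?_
  filter_upwards [eventually_gt_atTop 0, eventually_gt_atTop ρ] with R hR hρR
  obtain ⟨η, hη, hB⟩ := h R hR hρR
  have hηc := hη.contDiff.continuous
  have hi : Integrable fun x => f x * η x ^ 2 :=
    integrable_of_eq_zero_off_tsupport hη.hasCompactSupport (by fun_prop) fun x hx => by
      simp [image_eq_zero_of_notMem_tsupport hx]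
  have hci := (integrable_indicator_iff measurableSet_closedBall).2 hcb
  rw [← integral_indicator measurableSet_closedBall]
  refine le_trans ?_ (add_le_add le_rfl hB)
  rw [← integral_add hci hi, ← integral_indicator measurableSet_ball]
  refine integral_mono_of_nonneg
    (Eventually.of_forall fun x => indicator_nonneg (fun y _ => h0 y) x) (hci.add hi)
    (Eventually.of_forall fun x => ?_)
  have h1 : 0 ≤ f x * η x ^ 2 := mul_nonneg (h0 x) (sq_nonneg _)
  have h2 : 0 ≤ (closedBall 0 ρ).indicator f x := indicator_nonneg (fun y _ => h0 y) x
  change (ball 0 R).indicator f x ≤ (closedBall 0 ρ).indicator f x + f x * η x ^ 2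
  by_cases hxR : ‖x‖ < R
  · rw [indicator_of_mem (by simpa using hxR)]
    by_cases hxρ : ‖x‖ ≤ ρ
    · rw [indicator_of_mem (by simpa using hxρ)]; linarith
    · rw [hη.eq_one x (not_le.1 hxρ) hxR]; linarith
  · rw [indicator_of_notMem (by simpa using hxR)]; linarith

theorem tendsto_integral_mul_cutoff_sq {f : EuclideanSpace ℝ (Fin n) → ℝ} (hf : Integrable f)
    {ρ C : ℝ} (hρ : ρ < 0) {η : ℕ → EuclideanSpace ℝ (Fin n) → ℝ}
    (hη : ∀ m : ℕ, IsCutoff k ρ C (m + 1) (η m)) :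
    Tendsto (fun m => ∫ x, f x * η m x ^ 2) atTop (𝓝 (∫ x, f x)) := by
  refine tendsto_integral_of_dominated_convergence (fun x => ‖f x‖) (fun m => ?_) hf.norm
    (fun m => Eventually.of_forall fun x => ?_) (Eventually.of_forall fun x => ?_)
  · exact hf.aestronglyMeasurable.mul ((hη m).contDiff.continuous.pow 2).aestronglyMeasurable
  · rw [norm_mul, Real.norm_of_nonneg (sq_nonneg (η m x))]
    exact mul_le_of_le_one_right (norm_nonneg _)
      (pow_le_one₀ ((hη m).mem_Icc x).1 ((hη m).mem_Icc x).2)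
  · refine tendsto_const_nhds.congr' ?_
    obtain ⟨m₀, hm₀⟩ := exists_nat_gt ‖x‖
    filter_upwards [eventually_ge_atTop m₀] with m hm
    have : (m₀ : ℝ) ≤ m := by exact_mod_cast hm
    rw [(hη m).eq_one x (hρ.trans_le (norm_nonneg x)) (by linarith)]
    simp

theorem tendsto_integral_indicator_compl_ball {f : EuclideanSpace ℝ (Fin n) → ℝ}
    (hf : Integrable f) :
    Tendsto (fun m : ℕ => ∫ x, (ball 0 ((m : ℝ) + 1))ᶜ.indicator f x) atTop (𝓝 0) := by
  rw [← integral_zero (EuclideanSpace ℝ (Fin n)) ℝ]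
  refine tendsto_integral_of_dominated_convergence (fun x => ‖f x‖)
    (fun m => hf.aestronglyMeasurable.indicator measurableSet_ball.compl) hf.norm
    (fun m => Eventually.of_forall fun x => norm_indicator_le_norm_self _ _)
    (Eventually.of_forall fun x => ?_)
  refine tendsto_const_nhds.congr' ?_
  obtain ⟨m₀, hm₀⟩ := exists_nat_gt ‖x‖
  filter_upwards [eventually_ge_atTop m₀] with m hm
  have : (m₀ : ℝ) ≤ m := by exact_mod_cast hm
  rw [indicator_of_notMem]
  simp only [mem_compl_iff, mem_ball_zero_iff, not_not]
  linarith

theorem integrable_energy_of_stableOn_compl (ha : 0 ≤ a) (hp : 1 < p)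
    (hcrit : 4 + 2 * (a + 4) / (p - 1) = n) (hu : ContDiff ℝ (⊤ : ℕ∞) u)
    (hsol : IsSolutionOn n a p u Set.univ) {K : Set (EuclideanSpace ℝ (Fin n))}
    (hK : IsCompact K) (hstab : StableOn n a p u Kᶜ) :
    Integrable (fun x => lap n u x ^ 2) ∧ Integrable fun x => ‖x‖ ^ a * |u x| ^ (p + 1) := by
  have hp1 : 0 < p - 1 := by linarith
  obtain ⟨k, hk'⟩ := exists_nat_ge (4 / (p - 1))
  have hk : 4 ≤ k * (p - 1) := (div_le_iff₀ hp1).1 hk'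
  have hk0 : k ≠ 0 := by rintro rfl; norm_num at hk
  obtain ⟨r₀, hr₀⟩ := hK.isBounded.subset_closedBall 0
  set r := max r₀ 0 + 1
  have hr : 0 < r := by positivity
  have hr₀r : r₀ < r := lt_of_le_of_lt (le_max_left r₀ 0) (lt_add_one _)
  obtain ⟨χ, hχ, -, hχ01, hχ1, hχ2⟩ := exists_standard_cutoff n
  have hnorm : ∀ x : EuclideanSpace ℝ (Fin n), ‖r⁻¹ • x‖ = r⁻¹ * ‖x‖ := fun x => by
    rw [norm_smul, Real.norm_of_nonneg (inv_nonneg.2 hr.le)]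
  have hsupp : tsupport (fun x => 1 - χ (r⁻¹ • x)) ⊆ Kᶜ := by
    refine (closure_minimal (t := {x | r ≤ ‖x‖}) (fun x hx => ?_)
      (isClosed_le continuous_const continuous_norm)).trans fun x hx hxK => ?_
    · by_contra hlt
      refine hx ?_
      dsimp only
      rw [hχ1 _ (by rw [hnorm, inv_mul_le_iff₀ hr]; simpa using (not_le.1 hlt).le), sub_self]
    · have h1 : ‖x‖ ≤ r₀ := by simpa using hr₀ hxK
      exact (h1.trans_lt hr₀r).not_ge hx
  obtain ⟨C, hC, hcut⟩ := exists_isCutoff (k := k) (ρ := 2 * r)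
    (contDiff_const.sub (contDiff_comp_smul hχ r⁻¹))
    (fun x => ⟨sub_nonneg.2 (hχ01 _).2, sub_le_self _ (hχ01 _).1⟩)
    (fun x hx => by
      rw [hχ2 _ (by rw [hnorm, le_inv_mul_iff₀ hr]; linarith), sub_zero]) hk0
  set Q := 27 / (p - 1) + 40 with hQ
  have hQ0 : 0 < Q := by positivity
  obtain ⟨M, hM⟩ := exists_integral_cutoffError_le (k := k) (ρ := 2 * r) (ε := 1 / (2 * Q))
    ha hp hcrit hk hu hC (by positivity)
  have hbound : ∀ R, 0 < R → 2 * r < R → ∃ η, IsCutoff k (2 * r) C R η ∧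
      (∫ x, lap n u x ^ 2 * η x ^ 2) + (∫ x, ‖x‖ ^ a * |u x| ^ (p + 1) * η x ^ 2)
        ≤ 2 * Q * M := by
    intro R hR hrR
    obtain ⟨η, hη, hηs⟩ := hcut R hR hrR
    refine ⟨η, hη, ?_⟩
    have hS := hM R hR η hη
    have h1 := integral_lap_sq_le hp hu hη.contDiff hη.hasCompactSupport hsol
    have h2 := integral_weight_le_of_stableOn hp hu hη.contDiff hη.hasCompactSupport hsol
      hstab (hηs.trans hsupp)
    set X := ∫ x, ‖x‖ ^ a * |u x| ^ (p + 1) * η x ^ 2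
    set Z := ∫ x, lap n u x ^ 2 * η x ^ 2
    set I := ∫ x, cutoffError u η x
    have h3 : X ≤ 9 / (p - 1) * I := by
      rw [div_mul_eq_mul_div, le_div_iff₀ hp1]; linarith
    have h4 : Z + X ≤ Q * I := by
      have : Q * I = 3 * (9 / (p - 1) * I) + 40 * I := by rw [hQ]; ring
      linarith
    have h5 : 1 / (2 * Q) * (Z + X) ≤ 1 / 2 * I := by
      calc 1 / (2 * Q) * (Z + X) ≤ 1 / (2 * Q) * (Q * I) := by gcongr
        _ = 1 / 2 * I := by field_simp
    calc Z + X ≤ Q * I := h4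
      _ ≤ Q * (2 * M) := mul_le_mul_of_nonneg_left (by linarith) hQ0.le
      _ = 2 * Q * M := by ring
  have hLc : Continuous (lap n u) := hu.lap.continuous
  have hWc := continuous_weight ha hu (p + 1) (by linarith)
  have hW0 : ∀ x : EuclideanSpace ℝ (Fin n), 0 ≤ ‖x‖ ^ a * |u x| ^ (p + 1) := fun x => by
    positivity
  refine ⟨integrable_of_forall_cutoff_le (k := k) (ρ := 2 * r) (C := C) (B := 2 * Q * M)
      (hLc.pow 2) (fun x => sq_nonneg _) fun R hR hrR => ?_,
    integrable_of_forall_cutoff_le (k := k) (ρ := 2 * r) (C := C) (B := 2 * Q * M)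
      hWc hW0 fun R hR hrR => ?_⟩
  · obtain ⟨η, hη, hle⟩ := hbound R hR hrR
    have : 0 ≤ ∫ x, ‖x‖ ^ a * |u x| ^ (p + 1) * η x ^ 2 :=
      integral_nonneg fun x => mul_nonneg (hW0 x) (sq_nonneg _)
    exact ⟨η, hη, by linarith⟩
  · obtain ⟨η, hη, hle⟩ := hbound R hR hrR
    have : 0 ≤ ∫ x, lap n u x ^ 2 * η x ^ 2 :=
      integral_nonneg fun x => mul_nonneg (sq_nonneg _) (sq_nonneg _)
    exact ⟨η, hη, by linarith⟩

theorem integral_lap_sq_eq_of_integrable (ha : 0 ≤ a) (hp : 1 < p)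
    (hcrit : 4 + 2 * (a + 4) / (p - 1) = n) (hu : ContDiff ℝ (⊤ : ℕ∞) u)
    (hsol : IsSolutionOn n a p u Set.univ) (hL : Integrable fun x => lap n u x ^ 2)
    (hW : Integrable fun x => ‖x‖ ^ a * |u x| ^ (p + 1)) :
    ∫ x, lap n u x ^ 2 = ∫ x, ‖x‖ ^ a * |u x| ^ (p + 1) := by
  have hp1 : 0 < p - 1 := by linarith
  obtain ⟨k, hk'⟩ := exists_nat_ge (4 / (p - 1))
  have hk : 4 ≤ k * (p - 1) := (div_le_iff₀ hp1).1 hk'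
  have hk0 : k ≠ 0 := by rintro rfl; norm_num at hk
  obtain ⟨C, hC, hcut⟩ := exists_isCutoff (n := n) (k := k) (ρ := -1) (κ := fun _ => 1)
    contDiff_const (fun x => by simp) (fun x _ => rfl) hk0
  obtain ⟨M, hM⟩ := exists_integral_cutoffError_le (k := k) (ρ := -1) (ε := 1)
    ha hp hcrit hk hu hC one_pos
  have hRpos : ∀ m : ℕ, (0 : ℝ) < m + 1 := fun m => by positivity
  choose η hη hηs using fun m : ℕ => hcut (m + 1) (hRpos m) (by linarith [hRpos m])
  have hX := tendsto_integral_mul_cutoff_sq hW (by norm_num) hη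
  have hZ := tendsto_integral_mul_cutoff_sq hL (by norm_num) hη
  have htail := tendsto_integral_indicator_compl_ball hL
  set B := 60 * ((∫ x, lap n u x ^ 2) + (∫ x, ‖x‖ ^ a * |u x| ^ (p + 1)) + M)
  have hη2 : ∀ (m : ℕ) (x : EuclideanSpace ℝ (Fin n)), η m x ^ 2 ≤ 1 := fun m x =>
    pow_le_one₀ ((hη m).mem_Icc x).1 ((hη m).mem_Icc x).2
  have hY : ∀ m : ℕ, ∫ x, crossTerm u (η m) x ^ 2 ≤ B := by
    intro m
    have hηm := hη m
    have h1 := integral_crossTerm_sq_le hu hηm.contDiff hηm.hasCompactSupport hηm.mem_Icc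
    have h2 := hM _ (hRpos m) _ hηm
    have h3 : ∫ x, lap n u x ^ 2 * η m x ^ 2 ≤ ∫ x, lap n u x ^ 2 :=
      integral_mono (integrable_lap_sq_mul_sq hu hηm.contDiff hηm.hasCompactSupport) hL
        fun x => mul_le_of_le_one_right (sq_nonneg _) (hη2 m x)
    have h4 : ∫ x, ‖x‖ ^ a * |u x| ^ (p + 1) * η m x ^ 2 ≤ ∫ x, ‖x‖ ^ a * |u x| ^ (p + 1) :=
      integral_mono (integrable_weight_mul_sq ha hp hu hηm.contDiff hηm.hasCompactSupport) hW
        fun x => mul_le_of_le_one_right (by positivity) (hη2 m x)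
    linarith
  have hY0 : ∀ (m : ℕ) (x : EuclideanSpace ℝ (Fin n)), ‖x‖ < (m : ℝ) + 1 → crossTerm u (η m) x = 0 := by
    intro m x hx
    obtain ⟨h1, h2, -⟩ := (hη m).middle x (by linarith [norm_nonneg x]) hx
    have h3 : gradDot u (η m) x = 0 := by
      have := gradDot_sq_le (f := u) (g := η m) x
      rw [h1, mul_zero] at this
      exact pow_eq_zero_iff two_ne_zero |>.1 (le_antisymm this (sq_nonneg _))
    simp [crossTerm, h1, h2, h3]
  have hcross : ∀ l : ℝ, 0 < l → ∀ m : ℕ,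
      |(∫ x, ‖x‖ ^ a * |u x| ^ (p + 1) * η m x ^ 2) - ∫ x, lap n u x ^ 2 * η m x ^ 2| ≤
        l * (∫ x, (ball 0 ((m : ℝ) + 1))ᶜ.indicator (fun x => lap n u x ^ 2) x) + l⁻¹ * B := by
    intro l hl m
    have hηm := hη m
    rw [integral_weight_mul_sq hp hu hηm.contDiff hηm.hasCompactSupport hsol, add_sub_cancel_left]
    have hcY := continuous_crossTerm hu hηm.contDiff
    have hi1 : Integrable fun x => crossTerm u (η m) x ^ 2 :=
      integrable_of_eq_zero_off_tsupport hηm.hasCompactSupport (by fun_prop) fun x hx => by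
        simp [crossTerm_eq_zero hx]
    have hi2 : Integrable ((ball 0 ((m : ℝ) + 1))ᶜ.indicator fun x => lap n u x ^ 2) :=
      hL.indicator measurableSet_ball.compl
    have hle : ∫ x, |lap n u x * crossTerm u (η m) x| ≤
        ∫ x, (l * (ball 0 ((m : ℝ) + 1))ᶜ.indicator (fun x => lap n u x ^ 2) x +
          l⁻¹ * crossTerm u (η m) x ^ 2) := by
      refine integral_mono (integrable_lap_mul_crossTerm hu hηm.contDiff
        hηm.hasCompactSupport).abs ((hi2.const_mul _).add (hi1.const_mul _)) fun x => ?_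
      dsimp only
      by_cases hx : ‖x‖ < (m : ℝ) + 1
      · rw [indicator_of_notMem (by simpa using hx), hY0 m x hx]
        simp
      · rw [indicator_of_mem (by simpa using hx)]
        rw [abs_mul, ← sq_abs (lap n u x), ← sq_abs (crossTerm u (η m) x)]
        set A := |lap n u x|
        set D := |crossTerm u (η m) x|
        have hAD : 0 ≤ A * D := mul_nonneg (abs_nonneg _) (abs_nonneg _)
        have hid : l * A ^ 2 + l⁻¹ * D ^ 2 - 2 * (A * D) = (l * A - D) ^ 2 / l := by
          field_simp; ring
        have : 0 ≤ (l * A - D) ^ 2 / l := by positivity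
        linarith
    rw [integral_add (hi2.const_mul _) (hi1.const_mul _), integral_const_mul,
      integral_const_mul] at hle
    refine (abs_integral_le_integral_abs.trans hle).trans ?_
    gcongr
    exact hY m
  have hlim : ∀ l : ℝ, 0 < l →
      |(∫ x, ‖x‖ ^ a * |u x| ^ (p + 1)) - ∫ x, lap n u x ^ 2| ≤ l⁻¹ * B := by
    intro l hl
    have h1 := (hX.sub hZ).abs
    have h2 := (htail.const_mul l).add_const (l⁻¹ * B)
    rw [mul_zero, zero_add] at h2
    exact le_of_tendsto_of_tendsto' h1 h2 (hcross l hl)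
  have hB : Tendsto (fun l : ℝ => l⁻¹ * B) atTop (𝓝 0) := by
    simpa using tendsto_inv_atTop_zero.mul_const B
  have h0 := ge_of_tendsto hB ((eventually_gt_atTop 0).mono hlim)
  exact (sub_eq_zero.1 (abs_nonpos_iff.1 h0)).symm

end FiniteEnergy

/-- Theorem 1.2, critical case: at the critical exponent
`p = (n+4+2a)/(n-4)`, a smooth solution stable outside a compact set has finite energy
`∫ (Δu)² = ∫ |x|^a |u|^(p+1) < ∞`. -/
theorem stmt2 (n : ℕ) (hn : 5 ≤ n) (a p : ℝ) (ha : 0 ≤ a)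
    (hpc : p = ((n : ℝ) + 4 + 2 * a) / ((n : ℝ) - 4))
    (u : EuclideanSpace ℝ (Fin n) → ℝ) (hu : ContDiff ℝ (⊤ : ℕ∞) u)
    (hsol : IsSolutionOn n a p u Set.univ)
    (hstab : ∃ K : Set (EuclideanSpace ℝ (Fin n)), IsCompact K ∧ StableOn n a p u Kᶜ) :
    Integrable (fun x : EuclideanSpace ℝ (Fin n) => lap n u x ^ 2) ∧
    Integrable (fun x : EuclideanSpace ℝ (Fin n) => ‖x‖ ^ a * |u x| ^ (p + 1)) ∧
    (∫ x : EuclideanSpace ℝ (Fin n), lap n u x ^ 2) =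
      ∫ x : EuclideanSpace ℝ (Fin n), ‖x‖ ^ a * |u x| ^ (p + 1) := by
  obtain ⟨K, hK, hstabK⟩ := hstab
  have hn4 : (0 : ℝ) < (n : ℝ) - 4 := by
    have : (5 : ℝ) ≤ n := by exact_mod_cast hn
    linarith
  have hpm : p - 1 = 2 * (a + 4) / ((n : ℝ) - 4) := by
    rw [hpc]
    field_simp
    ring
  have hp : 1 < p := by
    have : 0 < p - 1 := by rw [hpm]; positivity
    linarith
  have hcrit : 4 + 2 * (a + 4) / (p - 1) = n := by
    rw [hpm, div_div_cancel₀ (by positivity)]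
    ring
  obtain ⟨hL, hW⟩ := integrable_energy_of_stableOn_compl ha hp hcrit hu hsol hK hstabK
  exact ⟨hL, hW, integral_lap_sq_eq_of_integrable ha hp hcrit hu hsol hL hW⟩
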